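/- Let Γ be a free group of rank r with free generating set S, let p be a prime, and let h : Γ → ℤ/pℤ be a nonzero finitely supported function. Then the convolution operator φ_h : (ℤ/pℤ)^Γ → (ℤ/pℤ)^Γ, defined by φ_h(x)(g) = Σ_{s ∈ Γ} x(g·s)·h(s⁻¹), is surjective. -/

import Mathlib

/-- The convolution operator `φ_h(x)(g) = Σ_s x(g·s)·h(s⁻¹)` on `(ℤ/pℤ)^Γ`,
for `Γ` the free group of rank `r`. -/
noncomputable def convOp {r p : ℕ} (h : FreeGroup (Fin r) → ZMod p)
    (x : FreeGroup (Fin r) → ZMod p) : FreeGroup (Fin r) → ZMod p :=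
  fun g => ∑ᶠ s : FreeGroup (Fin r), x (g * s) * h s⁻¹

/-- Existence of a unique product for the pair `A`, `B`. -/
def HasUP {G : Type} [Group G] (A B : Finset G) : Prop :=
  ∃ a0 ∈ A, ∃ b0 ∈ B, UniqueMul A B a0 b0

/-- The induction hypothesis: unique products for pairs of total size below `n`. -/
def UPBelow (n : ℕ) : Prop :=
  ∀ (G : Type) [Group G] [IsFreeGroup G] (A B : Finset G), A.Nonempty → B.Nonempty →
    A.card + B.card < n → HasUP A B

/-- A nontrivial free group has a homomorphism to `ℤ` nontrivial on any generating set. -/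
theorem exists_hom_ne_one {G : Type} [Group G] [IsFreeGroup G] [Nontrivial G] (S : Set G)
    (hS : Subgroup.closure S = ⊤) : ∃ f : G →* Multiplicative ℤ, ∃ s ∈ S, f s ≠ 1 := by
  let f : G →* Multiplicative ℤ := IsFreeGroup.lift (fun _ => Multiplicative.ofAdd (1 : ℤ))
  refine ⟨f, ?_⟩
  by_contra! hc
  have h1 : f = 1 := MonoidHom.eq_of_eqOn_dense hS (fun s hs => by simp [hc s hs])
  have hE : IsEmpty (IsFreeGroup.Generators G) := by
    refine ⟨fun a => ?_⟩
    have h2 : f (IsFreeGroup.of a) = Multiplicative.ofAdd (1 : ℤ) := IsFreeGroup.lift_of _ a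
    rw [h1] at h2
    have h3 := congrArg Multiplicative.toAdd h2
    simp at h3
  have : Subsingleton G := (IsFreeGroup.toFreeGroup G).toEquiv.subsingleton
  exact not_subsingleton G this

theorem up_step1 {n : ℕ} (ih : UPBelow n) {G : Type} [Group G] [IsFreeGroup G]
    (A B : Finset G) (hA : 1 ∈ A) (hB : 1 ∈ B) (hn : A.card + B.card ≤ n)
    (hcl : Subgroup.closure ((A : Set G) ∪ B) = ⊤) : HasUP A B := by
  classical
  rcases subsingleton_or_nontrivial G with hs | hs
  · exact ⟨1, hA, 1, hB, UniqueMul.of_subsingleton⟩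
  obtain ⟨f, s, hs, hfs⟩ := exists_hom_ne_one _ hcl
  let f' : G →ₙ* Multiplicative ℤ := f
  have hf1 : f' 1 = 1 := map_one f
  have hfs' : f' s ≠ 1 := hfs
  obtain ⟨x, hx, y, hy, hxy⟩ := UniqueProds.uniqueMul_of_nonempty
    (A := A.image f') (B := B.image f') ⟨_, Finset.mem_image_of_mem _ hA⟩
    ⟨_, Finset.mem_image_of_mem _ hB⟩
  obtain ⟨a, ha, hax⟩ := Finset.mem_image.1 hx
  obtain ⟨b, hb, hby⟩ := Finset.mem_image.1 hy
  have key : ∀ (C : Finset G) (z : Multiplicative ℤ), 1 ∈ C → s ∈ C →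
      ({c ∈ C | f' c = z} : Finset G).card < C.card := by
    intro C z h1 h2
    apply Finset.card_lt_card
    rw [Finset.filter_ssubset]
    by_cases hz : z = 1
    · exact ⟨s, h2, by rw [hz]; exact hfs'⟩
    · exact ⟨1, h1, by rw [hf1]; exact fun h => hz h.symm⟩
  have hlt : ({c ∈ A | f' c = x} : Finset G).card + ({c ∈ B | f' c = y} : Finset G).card < n := by
    have hA' := Finset.card_filter_le A (fun c => f' c = x)
    have hB' := Finset.card_filter_le B (fun c => f' c = y)
    rcases hs with h | h
    · have := key A x hA h
      omega
    · have := key B y hB h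
      omega
  obtain ⟨a0, ha0, b0, hb0, hu⟩ := ih G {c ∈ A | f' c = x} {c ∈ B | f' c = y}
    ⟨a, by simp [ha, hax]⟩ ⟨b, by simp [hb, hby]⟩ hlt
  rw [Finset.mem_filter] at ha0 hb0
  exact ⟨a0, ha0.1, b0, hb0.1, UniqueMul.of_image_filter f' ha0.2 hb0.2 hxy hu⟩

theorem up_step2 {n : ℕ} (ih : UPBelow n) {G : Type} [Group G] [IsFreeGroup G]
    (A B : Finset G) (hA : 1 ∈ A) (hB : 1 ∈ B) (hn : A.card + B.card ≤ n) : HasUP A B := by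
  classical
  let H := Subgroup.closure ((A : Set G) ∪ B)
  have hAH : ∀ a ∈ A, a ∈ H := fun a ha => Subgroup.subset_closure (Or.inl ha)
  have hBH : ∀ a ∈ B, a ∈ H := fun a ha => Subgroup.subset_closure (Or.inr ha)
  let A' : Finset H := A.subtype (· ∈ H)
  let B' : Finset H := B.subtype (· ∈ H)
  have hA' : A'.card ≤ A.card := by
    rw [Finset.card_subtype]; exact Finset.card_filter_le _ _
  have hB' : B'.card ≤ B.card := by
    rw [Finset.card_subtype]; exact Finset.card_filter_le _ _
  have hcl : Subgroup.closure ((A' : Set H) ∪ B') = ⊤ := by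
    have h := Subgroup.closure_closure_coe_preimage (k := (A : Set G) ∪ B)
    rw [← h]
    congr 1
    ext x
    simp [A', B']
  obtain ⟨a, ha, b, hb, hu⟩ := up_step1 ih A' B' (by simpa [A'] using hA) (by simpa [B'] using hB)
    (by omega) hcl
  refine ⟨a, by simpa [A'] using ha, b, by simpa [B'] using hb, ?_⟩
  intro c d hc hd hcd
  have := @hu ⟨c, hAH c hc⟩ ⟨d, hBH d hd⟩ (by simpa [A'] using hc) (by simpa [B'] using hd)
    (Subtype.ext hcd)
  exact ⟨congrArg Subtype.val this.1, congrArg Subtype.val this.2⟩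

theorem up_below (n : ℕ) : UPBelow n := by
  classical
  induction n with
  | zero => intro G _ _ A B _ _ h; omega
  | succ n ih =>
    intro G _ _ A B hA hB hn
    obtain ⟨a, ha⟩ := hA
    obtain ⟨b, hb⟩ := hB
    have h1 : (A.image (fun c => a⁻¹ * c)).card ≤ A.card := Finset.card_image_le
    have h2 : (B.image (fun c => c * b⁻¹)).card ≤ B.card := Finset.card_image_le
    obtain ⟨a0, ha0, b0, hb0, hu⟩ := up_step2 ih (A.image (fun c => a⁻¹ * c))
      (B.image (fun c => c * b⁻¹)) (Finset.mem_image.2 ⟨a, ha, by simp⟩)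
      (Finset.mem_image.2 ⟨b, hb, by simp⟩) (by omega)
    obtain ⟨a1, ha1, rfl⟩ := Finset.mem_image.1 ha0
    obtain ⟨b1, hb1, rfl⟩ := Finset.mem_image.1 hb0
    refine ⟨a1, ha1, b1, hb1, ?_⟩
    intro c d hc hd hcd
    have := hu (Finset.mem_image_of_mem _ hc) (Finset.mem_image_of_mem _ hd)
      (by
        calc a⁻¹ * c * (d * b⁻¹) = a⁻¹ * (c * d) * b⁻¹ := by group
          _ = a⁻¹ * (a1 * b1) * b⁻¹ := by rw [hcd]
          _ = _ := by group)
    simpa using this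

theorem freeGroup_uniqueProds (r : ℕ) : UniqueProds (FreeGroup (Fin r)) where
  uniqueMul_of_nonempty := fun {A B} hA hB =>
    up_below (A.card + B.card + 1) (FreeGroup (Fin r)) A B hA hB (by omega)

/-- for `p` prime and `h` nonzero finitely supported, `φ_h` is surjective. -/
theorem convOp_surjective {r p : ℕ} (hp : p.Prime)
    (h : FreeGroup (Fin r) → ZMod p)
    (hfin : (Function.support h).Finite) (hne : h ≠ 0) :
    Function.Surjective (convOp h) := by
  classical
  have : Fact p.Prime := ⟨hp⟩
  have := freeGroup_uniqueProds r
  have hkfin : (Function.support (fun s : FreeGroup (Fin r) => h s⁻¹)).Finite :=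
    hfin.preimage (f := fun s : FreeGroup (Fin r) => s⁻¹) inv_injective.injOn
  let k0 : FreeGroup (Fin r) →₀ ZMod p := Finsupp.ofSupportFinite _ hkfin
  let k : MonoidAlgebra (ZMod p) (FreeGroup (Fin r)) := .ofCoeff k0
  have hk : k ≠ 0 := by
    intro hk
    apply hne
    funext s
    have h1 : k0 = 0 := MonoidAlgebra.ofCoeff_eq_zero.1 hk
    have h2 : k0 s⁻¹ = 0 := by rw [h1]; rfl
    simpa [k0, Finsupp.ofSupportFinite_coe] using h2
  have hinj : Function.Injective (LinearMap.mulRight (ZMod p) k) :=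
    fun a b hab => mul_right_cancel₀ hk hab
  intro y
  let Y : Module.Dual (ZMod p) (MonoidAlgebra (ZMod p) (FreeGroup (Fin r))) :=
    (Finsupp.lsum (ZMod p) (fun g => y g • LinearMap.id)) ∘ₗ
      (MonoidAlgebra.coeffLinearEquiv (ZMod p)).toLinearMap
  obtain ⟨X, hX⟩ := LinearMap.dualMap_surjective_of_injective hinj Y
  refine ⟨fun g => X (MonoidAlgebra.single g 1), ?_⟩
  funext g
  have hY : Y (MonoidAlgebra.single g 1) = y g := by
    simp [Y]
  rw [← hY, ← hX]
  have hmul : MonoidAlgebra.single g 1 * k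
      = ∑ s ∈ k0.support, (k0 s) • MonoidAlgebra.single (g * s) (1 : ZMod p) := by
    have : k = ∑ s ∈ k0.support, MonoidAlgebra.single s (k0 s) :=
      (MonoidAlgebra.sum_coeff_single k).symm
    rw [this, Finset.mul_sum]
    simp [MonoidAlgebra.single_mul_single]
  rw [LinearMap.dualMap_apply, LinearMap.mulRight_apply, hmul, map_sum]
  unfold convOp
  rw [finsum_eq_sum_of_support_subset (s := k0.support)]
  · refine Finset.sum_congr rfl fun s _ => ?_
    rw [map_smul, smul_eq_mul, mul_comm]
    rfl
  · intro s hs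
    have : h s⁻¹ ≠ 0 := right_ne_zero_of_mul hs
    simpa [k0, Finsupp.ofSupportFinite_coe] using this
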